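/- arXiv:2506.03737 — 4 statements merged into one kernel-verified Lean document; each statement's English description precedes it below -/
import Mathlib

section
/- Let m > 1 and let A_1, A_2, …, A_m be n×n real matrices. Then A_1, …, A_m pairwise commute if and only if the ordered product exp(A_1 x_1)·exp(A_2 x_2)⋯exp(A_m x_m) equals exp(A_1 x_1 + A_2 x_2 + ⋯ + A_m x_m) for all real numbers x_1, x_2, …, x_m. -/
open Matrix NormedSpace

theorem List.prod_ofFn_eq_of_forall_ne {M : Type*} [Monoid M] {m : ℕ} (f : Fin m → M) (j : Fin m)
    (h : ∀ k, k ≠ j → f k = 1) : (List.ofFn f).prod = f j := by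
  induction m with
  | zero => exact j.elim0
  | succ m ih =>
    rw [List.ofFn_succ, List.prod_cons]
    cases j using Fin.cases with
    | zero =>
      rw [List.prod_eq_one, mul_one]
      intro x hx
      obtain ⟨k, rfl⟩ := (List.mem_ofFn' _ _).1 hx
      exact h _ (Fin.succ_ne_zero k)
    | succ j =>
      rw [h 0 (Fin.succ_ne_zero j).symm, one_mul]
      exact ih (fun k => f k.succ) j fun k hk => h _ fun e => hk (Fin.succ_injective _ e)

theorem List.prod_ofFn_eq_mul_of_lt {M : Type*} [Monoid M] {m : ℕ} (f : Fin m → M) {i j : Fin m}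
    (hij : i < j) (h : ∀ k, k ≠ i → k ≠ j → f k = 1) : (List.ofFn f).prod = f i * f j := by
  induction m with
  | zero => exact j.elim0
  | succ m ih =>
    rw [List.ofFn_succ, List.prod_cons]
    obtain ⟨j, rfl⟩ := Fin.exists_succ_eq.2 (Fin.ne_zero_of_lt hij)
    cases i using Fin.cases with
    | zero =>
      rw [List.prod_ofFn_eq_of_forall_ne (fun k => f k.succ) j]
      exact fun k hk => h _ (Fin.succ_ne_zero k) fun e => hk (Fin.succ_injective _ e)
    | succ i =>
      rw [h 0 (Fin.succ_ne_zero i).symm (Fin.succ_ne_zero j).symm, one_mul]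
      exact ih (fun k => f k.succ) (Fin.succ_lt_succ_iff.1 hij) fun k hk hk' =>
        h _ (fun e => hk (Fin.succ_injective _ e)) fun e => hk' (Fin.succ_injective _ e)

theorem NormedSpace.commute_of_forall_commute_exp_smul {𝔸 : Type*} [NormedRing 𝔸]
    [NormedAlgebra ℝ 𝔸] [CompleteSpace 𝔸] {X B : 𝔸}
    (h : ∀ t : ℝ, Commute X (exp (t • B))) : Commute X B := by
  have hB : HasDerivAt (fun t : ℝ => exp (t • B)) B 0 := by
    simpa using hasDerivAt_exp_smul_const (𝕂 := ℝ) B 0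
  have hr := hB.mul_const X
  rw [← funext fun t => (h t).eq] at hr
  exact (hB.const_mul X).unique hr

open scoped Norms.Operator in
theorem Matrix.commute_of_forall_commute_exp_smul {n : ℕ} {X B : Matrix (Fin n) (Fin n) ℝ}
    (h : ∀ t : ℝ, Commute X (exp (t • B))) : Commute X B :=
  NormedSpace.commute_of_forall_commute_exp_smul h

theorem Matrix.commute_of_exp_mul_exp {n : ℕ} {A B : Matrix (Fin n) (Fin n) ℝ}
    (h : ∀ s t : ℝ, exp (s • A) * exp (t • B) = exp (s • A + t • B)) : Commute A B := by
  have hexp (s t : ℝ) : Commute (exp (s • A)) (exp (t • B)) := by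
    have h' := h (-s) (-t)
    rw [neg_smul, neg_smul, ← neg_add, Matrix.exp_neg, Matrix.exp_neg, Matrix.exp_neg, ← h,
      ← Matrix.mul_inv_rev] at h'
    have hu : IsUnit (exp (t • B) * exp (s • A)) :=
      (Matrix.isUnit_exp _).mul (Matrix.isUnit_exp _)
    exact (Matrix.inv_inj h' ((Matrix.isUnit_iff_isUnit_det _).1 hu)).symm
  exact (commute_of_forall_commute_exp_smul fun s =>
    (commute_of_forall_commute_exp_smul (hexp s)).symm).symm

theorem Matrix.prod_ofFn_exp_of_commute {n m : ℕ} (f : Fin m → Matrix (Fin n) (Fin n) ℝ)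
    (h : ∀ i j, Commute (f i) (f j)) :
    (List.ofFn fun i => exp (f i)).prod = exp (∑ i, f i) := by
  induction m with
  | zero => simp
  | succ m ih =>
    rw [List.ofFn_succ, List.prod_cons, ih (fun i => f i.succ) fun i j => h _ _,
      Fin.sum_univ_succ, Matrix.exp_add_of_commute]
    exact Commute.sum_right _ _ _ fun i _ => h _ _

/-- for `m > 1`, the matrices `A 1, …, A m` pairwise commute iff the ordered
product `exp(A₁x₁) ⋯ exp(Aₘxₘ)` equals `exp(A₁x₁ + ⋯ + Aₘxₘ)` for all real `x₁, …, xₘ`. -/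
theorem pairwise_commute_iff_prod_exp_eq_exp_sum {n m : ℕ} (hm : 1 < m)
    (A : Fin m → Matrix (Fin n) (Fin n) ℝ) :
    (∀ i j, A i * A j = A j * A i) ↔
      ∀ x : Fin m → ℝ,
        (List.ofFn fun i => exp (x i • A i)).prod = exp (∑ i, x i • A i) := by
  constructor
  · intro h x
    exact Matrix.prod_ofFn_exp_of_commute _ fun i j =>
      ((show Commute (A i) (A j) from h i j).smul_left _).smul_right _
  · intro h
    have key {i j : Fin m} (hij : i < j) : Commute (A i) (A j) := by
      refine Matrix.commute_of_exp_mul_exp fun s t => ?_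
      have hx := h (Pi.single i s + Pi.single j t)
      rw [List.prod_ofFn_eq_mul_of_lt _ hij] at hx
      · simpa [hij.ne, hij.ne', add_smul, Finset.sum_add_distrib, Pi.single_apply, ite_smul]
          using hx
      · intro k hi hj
        simp [hi, hj]
    intro i j
    rcases lt_trichotomy i j with hij | rfl | hij
    · exact key hij
    · rfl
    · exact (key hij).symm
end

section
/- Let N > 1 and let A_1, …, A_N be skew-symmetric d×d real matrices, and define the rotation matrix function R(x) = exp(Σ_{i=1}^N x_i A_i) for x ∈ ℝ^N. Then there exists a function F : ℝ^N → ℝ^{d×d} such that R(x)ᵀ R(y) = F(y − x) for all x, y ∈ ℝ^N if and only if the matrices A_1, …, A_N pairwise commute. -/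
open Matrix NormedSpace

section BanachAlgebra

variable {B : Type*} [NormedRing B] [NormedAlgebra ℝ B] [CompleteSpace B]

theorem commute_of_forall_commute_exp_smul {a c : B} (h : ∀ t : ℝ, Commute (exp (t • a)) c) :
    Commute a c := by
  have ha : HasDerivAt (fun t : ℝ => exp (t • a)) a 0 := by
    simpa using hasDerivAt_exp_smul_const (𝕂 := ℝ) a 0
  have hl := ha.mul_const c
  have hr := ha.const_mul c
  rw [← funext fun t => (h t).eq] at hr
  exact hl.unique hr

theorem commute_of_forall_commute_exp_smul_exp_smul {a b : B}
    (h : ∀ s t : ℝ, Commute (exp (s • a)) (exp (t • b))) : Commute a b :=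
  commute_of_forall_commute_exp_smul fun s =>
    (commute_of_forall_commute_exp_smul fun t => (h s t).symm).symm

end BanachAlgebra

open scoped Norms.Operator in
theorem Matrix.commute_of_forall_commute_exp_smul_exp_smul {m : Type*} [Fintype m] [DecidableEq m]
    {P Q : Matrix m m ℝ} (h : ∀ s t : ℝ, Commute (exp (s • P)) (exp (t • Q))) : Commute P Q :=
  _root_.commute_of_forall_commute_exp_smul_exp_smul h

theorem transpose_exp_sum_smul_of_skew {ι m : Type*} [Fintype ι] [Fintype m] [DecidableEq m]
    {A : ι → Matrix m m ℝ} (hA : ∀ i, (A i)ᵀ = -A i) (x : ι → ℝ) :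
    (exp (∑ i, x i • A i))ᵀ = exp (∑ i, (-x) i • A i) := by
  simp [← Matrix.exp_transpose, Matrix.transpose_sum, hA]

/-- for `N > 1` and skew-symmetric `A₁, …, A_N`, with
`R(x) = exp(∑ xᵢ • Aᵢ)`, there exists `F` with `R(x)ᵀ * R(y) = F (y - x)` for all `x, y`
iff the `Aᵢ` pairwise commute. -/
theorem exists_relative_rotation_iff_pairwise_commute {N d : ℕ} (hN : 1 < N)
    (A : Fin N → Matrix (Fin d) (Fin d) ℝ) (hA : ∀ i, (A i)ᵀ = -A i) :
    (∃ F : (Fin N → ℝ) → Matrix (Fin d) (Fin d) ℝ,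
        ∀ x y : Fin N → ℝ,
          (exp (∑ i, x i • A i))ᵀ * exp (∑ i, y i • A i) = F (y - x)) ↔
      ∀ i j, A i * A j = A j * A i := by
  simp only [transpose_exp_sum_smul_of_skew hA]
  constructor
  · rintro ⟨F, hF⟩ i j
    have hadd (u v : Fin N → ℝ) :
        exp (∑ k, u k • A k) * exp (∑ k, v k • A k) = F (u + v) := by
      simpa [add_comm] using hF (-u) v
    refine (Matrix.commute_of_forall_commute_exp_smul_exp_smul fun s t => ?_).eq
    have h := (hadd (Pi.single i s) (Pi.single j t)).trans
      ((congrArg F (add_comm _ _)).trans (hadd (Pi.single j t) (Pi.single i s)).symm)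
    simpa [Pi.single_apply, ite_smul, commute_iff_eq] using h
  · intro hcomm
    refine ⟨fun z => exp (∑ i, z i • A i), fun x y => ?_⟩
    rw [← Matrix.exp_add_of_commute, ← Finset.sum_add_distrib]
    · simp [sub_eq_neg_add, add_smul]
    · exact Commute.sum_left _ _ _ fun i _ => Commute.sum_right _ _ _ fun j _ =>
        (Commute.smul_left (Commute.smul_right (hcomm i j) _) _)
end

section
/- Every rotation matrix is a matrix exponential of a skew-symmetric matrix: for any n×n real matrix R with Rᵀ R = I and det(R) = 1, there exists a skew-symmetric n×n real matrix A such that exp(A) = R. -/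
open Matrix NormedSpace
open Polynomial ComplexConjugate

open scoped Matrix.Norms.L2Operator in
theorem exp_aeval_eq_aeval {n : Type*} [Fintype n] [DecidableEq n] (M : Matrix n n ℂ)
    (hM : IsStarNormal M) (p q : ℂ[X]) (h : ∀ z ∈ spectrum ℂ M, Complex.exp (p.eval z) = q.eval z) :
    exp (aeval M p) = aeval M q := by
  have hn : IsStarNormal (aeval M p) := by
    rw [← cfc_polynomial (R := ℂ) p M]; infer_instance
  rw [← CFC.complex_exp_eq_normedSpace_exp (a := aeval M p) hn,
    ← cfc_polynomial p M, ← cfc_polynomial q M,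
    ← cfc_comp' Complex.exp (fun x => p.eval x) M]
  exact cfc_congr h

theorem exists_real_interpolation (s : Finset ℂ) (f : ℂ → ℂ) (hs : ∀ z ∈ s, conj z ∈ s)
    (hf : ∀ z ∈ s, f (conj z) = conj (f z)) : ∃ q : ℝ[X], ∀ z ∈ s, aeval z q = f z := by
  set p := Lagrange.interpolate s id f with hp
  have hev : ∀ z ∈ s, p.eval z = f z := fun z hz =>
    Lagrange.eval_interpolate_at_node f (Set.injOn_id _) hz
  have hconj : p.map (starRingEnd ℂ) = p := by
    refine Lagrange.eq_interpolate_of_eval_eq f (Set.injOn_id _) ?_ ?_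
    · rw [degree_map]
      exact Lagrange.degree_interpolate_lt f (Set.injOn_id _)
    · intro z hz
      have : (p.map (starRingEnd ℂ)).eval (conj (conj z)) = conj (p.eval (conj z)) := by
        rw [eval_map_apply]
      rw [Complex.conj_conj, hev _ (hs z hz), hf z hz, Complex.conj_conj] at this
      exact this
  have hl : p ∈ lifts Complex.ofRealHom := by
    rw [lifts_iff_coeff_lifts]
    intro k
    have := congrArg (fun r : ℂ[X] => r.coeff k) hconj
    simp only [coeff_map] at this
    obtain ⟨r, hr⟩ := Complex.conj_eq_iff_real.1 this
    exact ⟨r, hr.symm⟩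
  obtain ⟨q, hq⟩ := hl
  refine ⟨q, fun z hz => ?_⟩
  rw [← hev z hz, ← hq, coe_mapRingHom, eval_map, aeval_def]
  rfl

open scoped Matrix.Norms.L2Operator in
theorem exp_map_ofReal {n : Type*} [Fintype n] [DecidableEq n] (M : Matrix n n ℝ) :
    exp (M.map Complex.ofReal) = (exp M).map Complex.ofReal := by
  let _ : NormedAlgebra ℚ (Matrix n n ℝ) := .restrictScalars ℚ ℝ _
  exact (map_exp Complex.ofRealHom.mapMatrix
    (Continuous.matrix_map continuous_id Complex.continuous_ofReal) M).symm

theorem aeval_map_ofReal {n : Type*} [Fintype n] [DecidableEq n] (M : Matrix n n ℝ) (p : ℝ[X]) :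
    aeval (M.map Complex.ofReal) (p.map Complex.ofRealHom) = (aeval M p).map Complex.ofReal := by
  refine (map_aeval_eq_aeval_map (φ := Complex.ofRealHom) (ψ := Complex.ofRealHom.mapMatrix)
    ?_ p M).symm
  ext r i j
  by_cases hij : i = j <;> simp [algebraMap_matrix_apply, hij]

theorem map_ofReal_injective {n : Type*} :
    Function.Injective fun M : Matrix n n ℝ => M.map Complex.ofReal :=
  Matrix.map_injective Complex.ofReal_injective

theorem isStarNormal_map_ofReal {n : Type*} [Fintype n] {M : Matrix n n ℝ} (hM : Commute Mᵀ M) :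
    IsStarNormal (M.map Complex.ofReal) := by
  have hstar : star (M.map Complex.ofReal) = Mᵀ.map Complex.ofReal := by
    ext i j; simp [star_apply]
  refine ⟨?_⟩
  rw [hstar]
  have := congrArg (fun N : Matrix n n ℝ => N.map Complex.ofRealHom) hM.eq
  simp only [Matrix.map_mul] at this
  exact this

theorem eval_map_ofReal (p : ℝ[X]) (z : ℂ) : (p.map Complex.ofRealHom).eval z = aeval z p := by
  rw [eval_map, aeval_def]
  rfl

theorem exp_aeval_eq_aeval_of_real {n : Type*} [Fintype n] [DecidableEq n] {M : Matrix n n ℝ}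
    (hM : Commute Mᵀ M) (p q : ℝ[X])
    (h : ∀ z ∈ spectrum ℂ (M.map Complex.ofReal), Complex.exp (aeval z p) = aeval z q) :
    exp (aeval M p) = aeval M q := by
  apply map_ofReal_injective
  simp only
  rw [← exp_map_ofReal, ← aeval_map_ofReal, ← aeval_map_ofReal]
  refine exp_aeval_eq_aeval _ (isStarNormal_map_ofReal hM) _ _ fun z hz => ?_
  rw [eval_map_ofReal, eval_map_ofReal, h z hz]

open scoped Matrix.Norms.L2Operator in
theorem transpose_aeval_eq_neg {n : Type*} [Fintype n] [DecidableEq n] {M : Matrix n n ℝ}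
    (hM : Commute Mᵀ M) (p : ℝ[X])
    (h : ∀ z ∈ spectrum ℂ (M.map Complex.ofReal), conj (aeval z p) = - aeval z p) :
    (aeval M p)ᵀ = - aeval M p := by
  have hN := isStarNormal_map_ofReal hM
  have key : star (aeval (M.map Complex.ofReal) (p.map Complex.ofRealHom)) =
      - aeval (M.map Complex.ofReal) (p.map Complex.ofRealHom) := by
    rw [← cfc_polynomial (R := ℂ) _ (M.map Complex.ofReal), ← cfc_star, ← cfc_neg]
    refine cfc_congr fun z hz => ?_
    simp only [eval_map_ofReal]
    exact h z hz
  rw [aeval_map_ofReal] at key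
  ext i j
  have := congrFun (congrFun key i) j
  simp only [star_apply, Matrix.map_apply, Matrix.neg_apply, Complex.star_def, Complex.conj_ofReal]
    at this
  simpa using mod_cast this

open scoped Matrix.Norms.L2Operator in
theorem norm_eq_one_of_mem_spectrum {n : Type*} [Fintype n] [DecidableEq n] {R : Matrix n n ℝ}
    (hR : Rᵀ * R = 1) {z : ℂ} (hz : z ∈ spectrum ℂ (R.map Complex.ofReal)) : ‖z‖ = 1 := by
  refine spectrum.norm_eq_one_of_unitary (u := R.map Complex.ofReal) ?_ hz
  rw [← Matrix.unitaryGroup, mem_unitaryGroup_iff']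
  have hstar : star (R.map Complex.ofReal) = Rᵀ.map Complex.ofReal := by
    ext i j; simp [star_apply]
  have := congrArg (fun N : Matrix n n ℝ => N.map Complex.ofRealHom) hR
  simp only [Matrix.map_mul] at this
  rw [hstar]
  exact this.trans (Matrix.map_one _ (map_zero _) (map_one _))

theorem exists_polynomial_skew_log {n : Type*} [Fintype n] [DecidableEq n] {R : Matrix n n ℝ}
    (hR : Rᵀ * R = 1) (hdet : (R + 1).det ≠ 0) :
    ∃ q : ℝ[X], (aeval R q)ᵀ = -aeval R q ∧ exp (aeval R q) = R := by
  have hcomm : Commute Rᵀ R := hR.trans (mul_eq_one_comm.1 hR).symm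
  have hfin := Matrix.finite_spectrum (R.map Complex.ofReal)
  have hneg : (-1 : ℂ) ∉ spectrum ℂ (R.map Complex.ofReal) := by
    rw [spectrum.notMem_iff, isUnit_iff_isUnit_det, isUnit_iff_ne_zero]
    have h1 : algebraMap ℂ (Matrix n n ℂ) (-1) - R.map Complex.ofReal =
        -((R + 1).map Complex.ofRealHom) := by
      ext i j
      by_cases hij : i = j <;> simp [hij]; ring
    rw [h1, det_neg]
    refine mul_ne_zero (pow_ne_zero _ (by simp)) ?_
    have := Complex.ofRealHom.map_det (R + 1)
    rw [RingHom.mapMatrix_apply] at this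
    rw [← this]
    simpa using hdet
  classical
  set s := hfin.toFinset ∪ hfin.toFinset.image conj with hs
  have hsmem : ∀ z ∈ s, ‖z‖ = 1 ∧ z ≠ -1 := by
    intro z hz
    simp only [hs, Finset.mem_union, Finset.mem_image, Set.Finite.mem_toFinset] at hz
    rcases hz with hz | ⟨w, hw, rfl⟩
    · exact ⟨norm_eq_one_of_mem_spectrum hR hz, fun h => hneg (h ▸ hz)⟩
    · refine ⟨by rw [RCLike.norm_conj, norm_eq_one_of_mem_spectrum hR hw], fun h => hneg ?_⟩
      have : w = -1 := by simpa using congrArg conj h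
      exact this ▸ hw
  obtain ⟨q, hq⟩ := exists_real_interpolation s (fun z => Complex.I * z.arg) (by
    intro z hz
    simp only [hs, Finset.mem_union, Finset.mem_image] at hz ⊢
    rcases hz with hz | ⟨w, hw, rfl⟩
    · exact .inr ⟨z, hz, rfl⟩
    · exact .inl (by simpa using hw)) (by
    intro z hz
    have hpi : z.arg ≠ Real.pi := by
      intro h
      have := Complex.norm_mul_exp_arg_mul_I z
      rw [h, (hsmem z hz).1] at this
      exact (hsmem z hz).2 (by simpa using this.symm)
    simp [Complex.arg_conj, hpi])
  have hq' : ∀ z ∈ spectrum ℂ (R.map Complex.ofReal), aeval z q = Complex.I * z.arg :=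
    fun z hz => hq z (Finset.mem_union_left _ (hfin.mem_toFinset.2 hz))
  refine ⟨q, transpose_aeval_eq_neg hcomm q fun z hz => by rw [hq' z hz]; simp, ?_⟩
  refine (exp_aeval_eq_aeval_of_real hcomm q X fun z hz => ?_).trans (aeval_X R)
  have := Complex.norm_mul_exp_arg_mul_I z
  rw [norm_eq_one_of_mem_spectrum hR hz] at this
  rw [hq' z hz, aeval_X, mul_comm]
  simpa using this

theorem exp_pi_smul_of_skew {n : Type*} [Fintype n] [DecidableEq n] {J : Matrix n n ℝ}
    (hJ : Jᵀ = -J) (hJ3 : J * J * J = -J) : exp (Real.pi • J) = 1 + 2 • (J * J) := by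
  have h := exp_aeval_eq_aeval_of_real (M := J) (by rw [hJ]; exact (Commute.refl J).neg_left)
    (C Real.pi * X) (1 + (X ^ 2 + X ^ 2)) ?_
  · simpa [← Algebra.smul_def, pow_two, two_smul] using h
  intro z hz
  have hz0 : z * (z - Complex.I) * (z + Complex.I) = 0 := by
    have h0 : aeval (J.map Complex.ofReal) (X ^ 3 + X : ℂ[X]) = 0 := by
      have h1 := aeval_map_ofReal J (X ^ 3 + X)
      have h2 : aeval J (X ^ 3 + X : ℝ[X]) = 0 := by simp [pow_succ, hJ3]
      rw [h2] at h1
      simpa using h1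
    have h1 := spectrum.subset_polynomial_aeval (J.map Complex.ofReal) (X ^ 3 + X : ℂ[X])
      ⟨z, hz, rfl⟩
    rw [h0] at h1
    have h2 : z ^ 3 + z = 0 := by
      have : Nontrivial (Matrix n n ℂ) := by
        by_contra hn
        rw [not_nontrivial_iff_subsingleton] at hn
        rw [spectrum.of_subsingleton] at hz
        exact hz
      rw [spectrum.zero_eq] at h1
      simpa using h1
    linear_combination h2 - z * Complex.I_sq
  rcases mul_eq_zero.1 hz0 with h | h
  · rcases mul_eq_zero.1 h with h | h
    · simp [h]
    · rw [sub_eq_zero.1 h]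
      simp [Complex.exp_pi_mul_I]
  · rw [eq_neg_of_add_eq_zero_left h]
    simp [Complex.exp_neg, Complex.exp_pi_mul_I]

theorem exists_orthonormal_columns {n : Type*} [Fintype n] (V : Submodule ℝ (EuclideanSpace ℝ n)) :
    ∃ (m : ℕ) (B : Matrix n (Fin m) ℝ), Bᵀ * B = 1 ∧ (∀ k, WithLp.toLp 2 (Bᵀ k) ∈ V) ∧
      ∀ x, WithLp.toLp 2 x ∈ V → B *ᵥ (Bᵀ *ᵥ x) = x := by
  obtain ⟨m, ⟨b⟩⟩ : ∃ m, Nonempty (OrthonormalBasis (Fin m) ℝ V) :=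
    ⟨_, ⟨stdOrthonormalBasis ℝ V⟩⟩
  refine ⟨m, Matrix.of fun i k => (b k : EuclideanSpace ℝ n) i, ?_, fun k => (b k).2, ?_⟩
  · ext k l
    have := orthonormal_iff_ite.1 b.orthonormal k l
    rw [Submodule.coe_inner, PiLp.inner_apply] at this
    rw [Matrix.one_apply, ← this, Matrix.mul_apply]
    exact Finset.sum_congr rfl fun i _ => mul_comm _ _
  · intro x hxV
    have h := congrArg (fun v : V => (v : EuclideanSpace ℝ n))
      (b.sum_repr' ⟨WithLp.toLp 2 x, hxV⟩)
    ext i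
    have h := congrArg (fun v : EuclideanSpace ℝ n => v i) h
    simp only [Submodule.coe_inner, PiLp.inner_apply, Submodule.coe_sum, Submodule.coe_smul,
      WithLp.ofLp_sum, WithLp.ofLp_smul, Finset.sum_apply, Pi.smul_apply] at h
    rw [Matrix.mulVec, dotProduct]
    refine Eq.trans (Finset.sum_congr rfl fun k _ => ?_) h
    rw [smul_eq_mul, mul_comm]
    congr 1
    exact Finset.sum_congr rfl fun i _ => mul_comm _ _

theorem exists_orthonormal_columns_neg_one_eigenspace {n : Type*} [Fintype n] [DecidableEq n]
    (R : Matrix n n ℝ) : ∃ (m : ℕ) (B : Matrix n (Fin m) ℝ), Bᵀ * B = 1 ∧ R * B = -B ∧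
      ∀ x, R *ᵥ x = -x → B *ᵥ (Bᵀ *ᵥ x) = x := by
  have hmem (x : n → ℝ) :
      WithLp.toLp 2 x ∈ Module.End.eigenspace (Matrix.toEuclideanLin R) (-1) ↔ R *ᵥ x = -x := by
    rw [Module.End.mem_eigenspace_iff, Matrix.toLpLin_toLp, ← WithLp.toLp_smul, neg_one_smul,
      (WithLp.toLp_injective 2).eq_iff, Matrix.toLin'_apply]
  obtain ⟨m, B, hB, hBV, hV⟩ :=
    exists_orthonormal_columns (Module.End.eigenspace (Matrix.toEuclideanLin R) (-1))
  refine ⟨m, B, hB, ?_, fun x hx => hV x ((hmem x).2 hx)⟩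
  ext i k
  exact congrFun ((hmem _).1 (hBV k)) i

theorem exists_skew_sq_eq_neg_one {m : ℕ} (hm : Even m) :
    ∃ K : Matrix (Fin m) (Fin m) ℝ, Kᵀ = -K ∧ K * K = -1 := by
  obtain ⟨k, rfl⟩ := hm
  refine ⟨(Matrix.J (Fin k) ℝ).reindex finSumFinEquiv finSumFinEquiv, ?_, ?_⟩
  · rw [transpose_reindex, J_transpose]; rfl
  · simp only [reindex_apply]
    rw [submatrix_mul_equiv, J_squared, submatrix_neg, Pi.neg_apply]
    simp

/-- every rotation matrix (`Rᵀ R = 1`, `det R = 1`) is the exponential of a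
skew-symmetric matrix. -/
theorem exists_skewSymmetric_exp_eq_of_rotation {n : ℕ} (R : Matrix (Fin n) (Fin n) ℝ)
    (h1 : Rᵀ * R = 1) (h2 : R.det = 1) :
    ∃ A : Matrix (Fin n) (Fin n) ℝ, Aᵀ = -A ∧ exp A = R := by
  obtain ⟨m, B, hB, hRB, hker⟩ := exists_orthonormal_columns_neg_one_eigenspace R
  have hB' (X : Matrix (Fin m) (Fin n) ℝ) : Bᵀ * (B * X) = X := by
    rw [← Matrix.mul_assoc, hB, Matrix.one_mul]
  have hRB' (X : Matrix (Fin m) (Fin n) ℝ) : R * (B * X) = -(B * X) := by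
    rw [← Matrix.mul_assoc, hRB, Matrix.neg_mul]
  have hRtB : Rᵀ * B = -B := by
    rw [← neg_eq_iff_eq_neg, ← Matrix.mul_neg, ← hRB, ← Matrix.mul_assoc, h1, Matrix.one_mul]
  have hBR : Bᵀ * R = -Bᵀ := by
    simpa using congrArg transpose hRtB
  set S := R + 2 • (B * Bᵀ) with hS
  have hSB : S * B = B := by
    rw [hS, Matrix.add_mul, Matrix.smul_mul, Matrix.mul_assoc, hB, hRB, Matrix.mul_one]
    module
  have hBS : Bᵀ * S = Bᵀ := by
    rw [hS, Matrix.mul_add, Matrix.mul_smul, hB', hBR]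
    module
  have hSR : S * (1 - 2 • (B * Bᵀ)) = R := by
    rw [Matrix.mul_sub, Matrix.mul_one, Matrix.mul_smul, ← Matrix.mul_assoc, hSB, hS]
    abel
  have hRS : R * (1 - 2 • (B * Bᵀ)) = S := by
    rw [Matrix.mul_sub, Matrix.mul_one, Matrix.mul_smul, hRB', hS]
    module
  have hSS : Sᵀ * S = 1 := by
    have : Sᵀ = Rᵀ + 2 • (B * Bᵀ) := by
      rw [hS, transpose_add, transpose_smul, transpose_mul, transpose_transpose]
    rw [this, Matrix.add_mul, Matrix.smul_mul, Matrix.mul_assoc, hBS, hS, Matrix.mul_add, h1,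
      Matrix.mul_smul, ← Matrix.mul_assoc, hRtB, Matrix.neg_mul]
    module
  have hdet : (S + 1).det ≠ 0 := by
    intro h
    obtain ⟨x, hx0, hx⟩ := exists_mulVec_eq_zero_iff.2 h
    rw [add_mulVec, one_mulVec, add_eq_zero_iff_eq_neg] at hx
    have hBx : Bᵀ *ᵥ x = 0 := by
      have := congrArg (Bᵀ *ᵥ ·) hx
      simp only [mulVec_mulVec, hBS, mulVec_neg] at this
      exact self_eq_neg.1 this
    have hRx : R *ᵥ x = -x := by
      rw [hS, add_mulVec, smul_mulVec, ← mulVec_mulVec, hBx] at hx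
      simpa using hx
    apply hx0
    rw [← hker x hRx, hBx, mulVec_zero]
  obtain ⟨q, hq, hexp⟩ := exists_polynomial_skew_log hSS hdet
  have hm : Even m := by
    have hd : S.det = (-1) ^ m := by
      rw [← hRS, det_mul, h2, one_mul, ← Matrix.smul_mul, det_one_sub_mul_comm, Matrix.mul_smul, hB]
      have : (1 - 2 • 1 : Matrix (Fin m) (Fin m) ℝ) = -1 := by module
      rw [this, det_neg]
      simp
    have hpos : 0 ≤ S.det := by
      have : S = exp ((2⁻¹ : ℝ) • aeval S q) * exp ((2⁻¹ : ℝ) • aeval S q) := by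
        rw [← exp_add_of_commute _ _ (Commute.refl _), ← add_smul]
        norm_num [hexp]
      rw [this, det_mul]
      exact mul_self_nonneg _
    by_contra ho
    rw [hd, (Nat.not_even_iff_odd.1 ho).neg_one_pow] at hpos
    linarith
  obtain ⟨K, hK, hKK⟩ := exists_skew_sq_eq_neg_one hm
  set J := B * (K * Bᵀ) with hJ
  have hJt : Jᵀ = -J := by
    simp [hJ, hK, Matrix.mul_assoc]
  have hJJ : J * J = -(B * Bᵀ) := by
    rw [hJ, Matrix.mul_assoc, Matrix.mul_assoc, hB', ← Matrix.mul_assoc K, hKK]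
    simp
  have hJ3 : J * J * J = -J := by
    rw [hJJ, Matrix.neg_mul, Matrix.mul_assoc, hJ, hB']
  have hcomm : Commute S J := by
    rw [Commute, SemiconjBy, hJ, ← Matrix.mul_assoc, hSB, Matrix.mul_assoc, Matrix.mul_assoc, hBS]
  have hcomm' : Commute (aeval S q) (Real.pi • J) :=
    (Algebra.commute_of_mem_adjoin_singleton_of_commute
      (aeval_mem_adjoin_singleton ℝ S) hcomm.symm).symm.smul_right _
  refine ⟨aeval S q + Real.pi • J, ?_, ?_⟩
  · rw [transpose_add, transpose_smul, hq, hJt, smul_neg, neg_add]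
  · rw [exp_add_of_commute _ _ hcomm', hexp, exp_pi_smul_of_skew hJt hJ3, hJJ, smul_neg,
      ← sub_eq_add_neg, hSR]
end

section
/- Let A_1, …, A_N be skew-symmetric d×d real matrices that pairwise commute, and define R(x) = exp(Σ_{i=1}^N x_i A_i) for x ∈ ℝ^N. Then for all vectors q, k ∈ ℝ^d and all x, y ∈ ℝ^N, (R(x)q)ᵀ (R(y)k) = qᵀ R(y − x) k; that is, the function f(q, x) = R(x)q satisfies the RoPE Equation. -/
open Matrix NormedSpace

/-- for pairwise commuting skew-symmetric `A₁, …, A_N` and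
`R(x) = exp(∑ xᵢ • Aᵢ)`, the RoPE equation `(R(x)q)ᵀ (R(y)k) = qᵀ R(y − x) k` holds. -/
theorem rope_equation_of_commuting_skewSymmetric {d N : ℕ}
    (A : Fin N → Matrix (Fin d) (Fin d) ℝ) (hA : ∀ i, (A i)ᵀ = -A i)
    (hc : ∀ i j, A i * A j = A j * A i)
    (q k : Fin d → ℝ) (x y : Fin N → ℝ) :
    (exp (∑ i, x i • A i)).mulVec q ⬝ᵥ (exp (∑ i, y i • A i)).mulVec k =
      q ⬝ᵥ (exp (∑ i, (y - x) i • A i)).mulVec k := by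
  have hskew : (∑ i, x i • A i)ᵀ = -∑ i, x i • A i := by
    simp [transpose_sum, hA]
  have hcomm : Commute (-∑ i, x i • A i) (∑ i, y i • A i) :=
    (Commute.sum_left _ _ _ fun i _ => Commute.sum_right _ _ _ fun j _ =>
      (Commute.smul_left (Commute.smul_right (hc i j) _) _)).neg_left
  have hsum : ∑ i, (y - x) i • A i = -(∑ i, x i • A i) + ∑ i, y i • A i := by
    simp only [Pi.sub_apply, sub_smul, Finset.sum_sub_distrib]
    abel
  rw [hsum, Matrix.exp_add_of_commute _ _ hcomm, ← hskew, Matrix.exp_transpose,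
    ← mulVec_mulVec, dotProduct_mulVec q, vecMul_transpose]
end
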